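/- Let x, x' ∈ {−1,+1}^N be states and i an index such that x'_j = x_j for all j ≠ i, h_i(x) ≠ 0, and x'_i = sign(h_i(x)) ≠ x_i. Then E(x') < E(x). That is, the energy of the bipolar recurrent correlation neural network strictly decreases whenever a single (asynchronously updated) neuron changes its state. -/

import Mathlib

open scoped Classical

/-- Correlation of the state `x` with the `ξ`-th fundamental memory. -/
noncomputable def overlap {N P : ℕ} (u : Fin P → Fin N → ℝ) (x : Fin N → ℝ) (ξ : Fin P) : ℝ :=
  ∑ i, u ξ i * x i

/-- Activation potential of the `i`-th neuron: `h_i(x) = Σ_ξ f(Σ_j u_j^ξ x_j) u_i^ξ`. -/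
noncomputable def pot {N P : ℕ} (f : ℝ → ℝ) (u : Fin P → Fin N → ℝ) (x : Fin N → ℝ)
    (i : Fin N) : ℝ :=
  ∑ ξ, f (overlap u x ξ) * u ξ i

/-- Synchronous update of the bipolar recurrent correlation neural network. -/
noncomputable def upd {N P : ℕ} (f : ℝ → ℝ) (u : Fin P → Fin N → ℝ) (x : Fin N → ℝ) :
    Fin N → ℝ :=
  fun i => if pot f u x i ≠ 0 then Real.sign (pot f u x i) else x i

/-- Energy of the bipolar recurrent correlation neural network. -/
noncomputable def energy {N P : ℕ} (F : ℝ → ℝ) (u : Fin P → Fin N → ℝ) (x : Fin N → ℝ) : ℝ :=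
  -∑ ξ, F (overlap u x ξ)

lemma tangent_le (f F : ℝ → ℝ) (hmono : Monotone f)
    (hF : ∀ t : ℝ, HasDerivAt F (f t) t) (a b : ℝ) : f a * (b - a) ≤ F b - F a := by
  have hc : Continuous F := continuous_iff_continuousAt.2 fun t => (hF t).continuousAt
  rcases lt_trichotomy a b with h | h | h
  · obtain ⟨c, hc1, hc2⟩ := exists_hasDerivAt_eq_slope F f h hc.continuousOn (fun t _ => hF t)
    rw [eq_div_iff (by linarith)] at hc2
    have := hmono hc1.1.le
    nlinarith
  · simp [h]
  · obtain ⟨c, hc1, hc2⟩ := exists_hasDerivAt_eq_slope F f h hc.continuousOn (fun t _ => hF t)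
    rw [eq_div_iff (by linarith)] at hc2
    have := hmono hc1.2.le
    nlinarith

/-- The energy of the bipolar RCNN strictly decreases whenever a single
(asynchronously updated) neuron changes its state. -/
theorem bipolar_energy_decreases_async {N P : ℕ} (hN : 1 ≤ N) (hP : 1 ≤ P)
    (f F : ℝ → ℝ) (hf : Continuous f) (hmono : Monotone f)
    (hF : ∀ t : ℝ, HasDerivAt F (f t) t)
    (u : Fin P → Fin N → ℝ) (hu : ∀ ξ i, u ξ i = 1 ∨ u ξ i = -1)
    (x x' : Fin N → ℝ) (hx : ∀ j, x j = 1 ∨ x j = -1) (hx' : ∀ j, x' j = 1 ∨ x' j = -1)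
    (i : Fin N) (hsame : ∀ j, j ≠ i → x' j = x j)
    (hpne : pot f u x i ≠ 0)
    (hupd : x' i = Real.sign (pot f u x i))
    (hchange : x' i ≠ x i) :
    energy F u x' < energy F u x := by
  have hd : ∀ ξ, overlap u x' ξ - overlap u x ξ = u ξ i * (x' i - x i) := by
    intro ξ
    unfold overlap
    rw [← Finset.sum_sub_distrib, Finset.sum_eq_single i]
    · ring
    · intro j _ hj
      rw [hsame j hj]
      ring
    · simp
  have hsum : pot f u x i * (x' i - x i) ≤
      ∑ ξ, F (overlap u x' ξ) - ∑ ξ, F (overlap u x ξ) := by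
    unfold pot
    rw [← Finset.sum_sub_distrib, Finset.sum_mul]
    refine Finset.sum_le_sum fun ξ _ => ?_
    have := tangent_le f F hmono hF (overlap u x ξ) (overlap u x' ξ)
    rw [hd ξ] at this
    linarith
  have hpos : 0 < pot f u x i * (x' i - x i) := by
    rcases lt_or_gt_of_ne hpne with h | h
    · rw [Real.sign_of_neg h] at hupd
      rcases hx i with h1 | h1
      · rw [hupd, h1]; linarith
      · exact absurd (hupd.trans h1.symm) hchange
    · rw [Real.sign_of_pos h] at hupd
      rcases hx i with h1 | h1
      · exact absurd (hupd.trans h1.symm) hchange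
      · rw [hupd, h1]; linarith
  unfold energy
  linarith
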